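/- The deque-state function is well defined on Mazurkiewicz traces: if u and v are finite words over Σ that are trace equivalent (u ∼_I v, i.e., u can be transformed into v by finitely many swaps of adjacent letters (a,b) with (a,b) ∈ I), then d_state(i, u) = d_state(i, v) for every process index i. -/

import Mathlib

/-! Multiple Idempotent Work Stealing Deque: `d_state` is well defined on Mazurkiewicz traces over `I = (Σ × Σ) \ ⋃_i (O_i × O_i)`. -/

inductive WOp (n : ℕ) (T V : Type*) where
  | addResult : T → V → WOp n T V
  | pushBottom : Fin n → T → WOp n T V
  | popBottom : Fin n → WOp n T V
  | remove : Fin n → T → WOp n T V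
deriving DecidableEq

/-- One step of the deque state of process `i`: the effect of a single letter
on `d_state(i, ·)` (`none` encodes the non-value `⊥`). -/
def step {n : ℕ} {T V : Type*} [DecidableEq T] (i : Fin n)
    (s : Option (List T)) (a : WOp n T V) : Option (List T) :=
  match s, a with
  | none, _ => none
  | some l, .pushBottom j t => if j = i then some (l ++ [t]) else some l
  | some l, .popBottom j =>
      if j = i then (match l with | [] => none | _ :: tl => some tl) else some l
  | some l, .remove j t =>
      if j = i then some (l.filter (fun x => decide (x ≠ t))) else some l
  | some l, .addResult _ _ => some l

/-- `d_state(i, v)`: the content of process `i`'s deque after the word `v`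
(`none` is the non-value `⊥`). -/
def dstate {n : ℕ} {T V : Type*} [DecidableEq T] (i : Fin n)
    (v : List (WOp n T V)) : Option (List T) :=
  v.foldl (step i) (some [])

/-- Membership of a letter in the alphabet `Σ`: `addResult t r` requires a
valid result, and `pushBottom i t`, `remove i t` require `t ∈ 𝕋_i`
(the partition of tasks is encoded by `towner : T → Fin n`). -/
def inSig {n : ℕ} {T V : Type*} (towner : T → Fin n) (valid : T → V → Prop) :
    WOp n T V → Prop
  | .addResult t r => valid t r
  | .pushBottom i t => towner t = i
  | .popBottom _ => True
  | .remove i t => towner t = i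

/-- The letter belongs to `O_i`, the set of updates exclusive to process `i`. -/
def inO {n : ℕ} {T V : Type*} (i : Fin n) : WOp n T V → Prop
  | .addResult _ _ => False
  | .pushBottom j _ => j = i
  | .popBottom j => j = i
  | .remove j _ => j = i

/-- The trace language `L` of a Multiple Idempotent Work Stealing Deque:
each `pushBottom i t` occurs at most once, and no deque state is `⊥`. -/
def wsdL {n : ℕ} {T V : Type*} [DecidableEq T] [DecidableEq V]
    (v : List (WOp n T V)) : Prop :=
  (∀ (i : Fin n) (t : T), v.count (WOp.pushBottom i t) ≤ 1) ∧
  (∀ i : Fin n, dstate i v ≠ none)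

/-- The independence relation `I`: two letters are independent iff they do not
belong to the same `O_i`. -/
def indep {n : ℕ} {T V : Type*} (a b : WOp n T V) : Prop :=
  ¬ ∃ i : Fin n, inO i a ∧ inO i b

/-- A single swap of two adjacent independent letters. -/
inductive TraceStep {n : ℕ} {T V : Type*} :
    List (WOp n T V) → List (WOp n T V) → Prop
  | swap (u w : List (WOp n T V)) (a b : WOp n T V) (h : indep a b) :
      TraceStep (u ++ a :: b :: w) (u ++ b :: a :: w)

/-- Trace equivalence `u ∼_I v`: `u` can be transformed into `v` by finitely
many swaps of adjacent independent letters. -/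
def TraceEq {n : ℕ} {T V : Type*} :
    List (WOp n T V) → List (WOp n T V) → Prop :=
  Relation.ReflTransGen TraceStep

theorem step_of_not_inO {n : ℕ} {T V : Type*} [DecidableEq T] (i : Fin n)
    (s : Option (List T)) (a : WOp n T V) (h : ¬ inO i a) : step i s a = s := by
  cases s <;> cases a <;> simp_all [step, inO]

theorem step_comm_of_indep {n : ℕ} {T V : Type*} [DecidableEq T] (i : Fin n)
    (s : Option (List T)) (a b : WOp n T V) (h : indep a b) :
    step i (step i s a) b = step i (step i s b) a := by
  by_cases ha : inO i a
  · have hb : ¬ inO i b := fun hb => h ⟨i, ha, hb⟩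
    rw [step_of_not_inO i _ b hb, step_of_not_inO i _ b hb]
  · rw [step_of_not_inO i _ a ha, step_of_not_inO i _ a ha]

/-- If `u` and `v` are words over `Σ` with `u ∼_I v`, then
`d_state(i, u) = d_state(i, v)` for every process `i`. -/
theorem dstate_well_defined_on_traces {n : ℕ} {T V : Type*}
    [DecidableEq T] [DecidableEq V]
    (towner : T → Fin n) (valid : T → V → Prop)
    (u v : List (WOp n T V))
    (hu : ∀ a ∈ u, inSig towner valid a) (hv : ∀ a ∈ v, inSig towner valid a)
    (huv : TraceEq u v) :
    ∀ i : Fin n, dstate i u = dstate i v := by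
  intro i
  clear hu hv
  unfold TraceEq at huv
  induction huv with
  | refl => rfl
  | tail _ hs ih =>
    rw [ih]
    cases hs with
    | swap p w a b h =>
      simp only [dstate, List.foldl_append, List.foldl_cons]
      rw [step_comm_of_indep i _ a b h]
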